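/- Let F be a field, n ≥ 1, and let x₁,…,xₙ ∈ F with each xᵢ ∉ {0,1,−1}, and set z = ∏_{i=1}^n (1−xᵢ)/(1+xᵢ) (a nonzero element of F). Then in the (n+1)-st exterior power over ℚ of the ℚ-vector space ℚ ⊗_ℤ Fˣ, one has x₁∧⋯∧xₙ∧z = ∑_{i=1}^n (−1)^{i(n−1)} ( xᵢ∧(1−xᵢ)∧x_{i+1}∧⋯∧x_{i+n−1} − xᵢ∧(1+xᵢ)∧x_{i+1}∧⋯∧x_{i+n−1} ), where the indices are read cyclically, i.e. x_{i+n} = x_i. -/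

import Mathlib

open scoped TensorProduct
open scoped Classical

set_option synthInstance.maxHeartbeats 1000000
set_option maxHeartbeats 1000000

/-- The image of a nonzero field element in the exterior algebra (over `ℚ`) of the
`ℚ`-vector space `ℚ ⊗_ℤ Fˣ`; zero is sent to `0`.  Wedge products of units are then
given by multiplication in the exterior algebra. -/
noncomputable def wedgeGen (F : Type) [Field F] (u : F) :
    ExteriorAlgebra ℚ (ℚ ⊗[ℤ] Additive Fˣ) :=
  if h : u = 0 then 0
  else ExteriorAlgebra.ι ℚ ((1 : ℚ) ⊗ₜ[ℤ] (Additive.ofMul (Units.mk0 u h)))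

section Anticommuting

variable {A : Type*} [Ring A]

theorem List.prod_map_range_mul_of_anticommute (g : ℕ → A) (b : A)
    (h : ∀ j, g j * b = -(b * g j)) (m : ℕ) :
    ((List.range m).map g).prod * b = (-1) ^ m * (b * ((List.range m).map g).prod) := by
  induction m with
  | zero => simp
  | succ m ih =>
    rw [List.range_succ, List.map_append, List.prod_append, List.map_singleton,
      List.prod_singleton, mul_assoc, h, mul_neg, ← mul_assoc, ih, pow_succ]
    simp only [mul_assoc, neg_mul, mul_neg, one_mul]

theorem List.prod_map_range_succ_shift_of_anticommute (g : ℕ → A) (m : ℕ)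
    (hg : ∀ i j, g i * g j = -(g j * g i)) (hcyc : ∀ i, g (i + (m + 1)) = g i) (i : ℕ) :
    ((List.range (m + 1)).map fun j => g (i + 1 + j)).prod
      = (-1) ^ m * ((List.range (m + 1)).map fun j => g (i + j)).prod := by
  have hlast : g (i + 1 + m) = g i := by rw [← hcyc i]; congr 1; omega
  rw [List.prod_range_succ, hlast,
    List.prod_map_range_mul_of_anticommute _ _ fun j => hg _ _, List.prod_range_succ']
  simp only [add_zero, Nat.succ_eq_add_one, add_assoc, add_comm 1]

theorem List.prod_map_range_rotate_of_anticommute (g : ℕ → A) (m : ℕ)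
    (hg : ∀ i j, g i * g j = -(g j * g i)) (hcyc : ∀ i, g (i + (m + 1)) = g i) (k : ℕ) :
    ((List.range (m + 1)).map fun j => g (k + 1 + j)).prod
      = (-1) ^ (k * m) * ((List.range (m + 1)).map fun j => g (j + 1)).prod := by
  induction k with
  | zero => simp [add_comm]
  | succ k ih =>
    rw [List.prod_map_range_succ_shift_of_anticommute g m hg hcyc, ih, ← mul_assoc, ← pow_add]
    congr 2
    ring

theorem List.prod_map_range_mul_eq_insert_of_anticommute (g : ℕ → A) (b : A) (m : ℕ)
    (hg : ∀ i j, g i * g j = -(g j * g i)) (hcyc : ∀ i, g (i + (m + 1)) = g i)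
    (hb : ∀ i, g i * b = -(b * g i)) (k : ℕ) :
    ((List.range (m + 1)).map fun j => g (j + 1)).prod * b
      = (-1) ^ ((k + 1) * m) *
        (g (k + 1) * b * ((List.range m).map fun j => g (k + 1 + 1 + j)).prod) := by
  have hsq (p : ℕ) : ((-1) ^ p * (-1) ^ p : A) = 1 := by
    rw [← pow_add, Even.neg_one_pow ⟨p, rfl⟩]
  have hcomm (p : ℕ) (a : A) : a * (-1) ^ p = (-1) ^ p * a :=
    ((Commute.neg_one_right a).pow_right p).eq
  have hinsert : b * ((List.range m).map fun j => g (k + 1 + 1 + j)).prod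
      = (-1) ^ m * (((List.range m).map fun j => g (k + 1 + 1 + j)).prod * b) := by
    rw [List.prod_map_range_mul_of_anticommute _ _ fun j => hb _, ← mul_assoc, hsq, one_mul]
  have hfirst : ((List.range (m + 1)).map fun j => g (k + 1 + j)).prod
      = g (k + 1) * ((List.range m).map fun j => g (k + 1 + 1 + j)).prod := by
    rw [List.prod_range_succ']
    simp only [add_zero, Nat.succ_eq_add_one, add_assoc, add_comm 1]
  have hrot := List.prod_map_range_rotate_of_anticommute g m hg hcyc k
  rw [hfirst] at hrot
  rw [mul_assoc (g (k + 1)), hinsert, ← mul_assoc (g (k + 1)), hcomm, mul_assoc ((-1) ^ m),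
    ← mul_assoc (g (k + 1)), hrot, mul_assoc, ← mul_assoc, ← mul_assoc, ← pow_add,
    show (k + 1) * m + m = k * m + (m + m) by ring, pow_add, pow_add _ m m, hsq, mul_one,
    ← mul_assoc, hsq, one_mul]

end Anticommuting

section WedgeGen

variable (F : Type) [Field F]

theorem wedgeGen_of_ne_zero {u : F} (h : u ≠ 0) : wedgeGen F u =
    ExteriorAlgebra.ι ℚ ((1 : ℚ) ⊗ₜ[ℤ] (Additive.ofMul (Units.mk0 u h))) :=
  dif_neg h

theorem wedgeGen_one : wedgeGen F 1 = 0 := by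
  rw [wedgeGen_of_ne_zero F one_ne_zero, Units.mk0_one, ofMul_one, TensorProduct.tmul_zero,
    map_zero]

theorem wedgeGen_mul {u v : F} (hu : u ≠ 0) (hv : v ≠ 0) :
    wedgeGen F (u * v) = wedgeGen F u + wedgeGen F v := by
  rw [wedgeGen_of_ne_zero F hu, wedgeGen_of_ne_zero F hv,
    wedgeGen_of_ne_zero F (mul_ne_zero hu hv), Units.mk0_mul, ofMul_mul, TensorProduct.tmul_add,
    map_add]

theorem wedgeGen_div {u v : F} (hu : u ≠ 0) (hv : v ≠ 0) :
    wedgeGen F (u / v) = wedgeGen F u - wedgeGen F v := by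
  rw [eq_sub_iff_add_eq, ← wedgeGen_mul F (div_ne_zero hu hv) hv, div_mul_cancel₀ u hv]

theorem wedgeGen_prod {ι : Type*} (s : Finset ι) (f : ι → F) (hf : ∀ i ∈ s, f i ≠ 0) :
    wedgeGen F (∏ i ∈ s, f i) = ∑ i ∈ s, wedgeGen F (f i) := by
  induction s using Finset.induction_on with
  | empty => simp [wedgeGen_one]
  | insert a s ha ih =>
    have hs : ∀ i ∈ s, f i ≠ 0 := fun i hi => hf i (Finset.mem_insert_of_mem hi)
    rw [Finset.prod_insert ha, Finset.sum_insert ha,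
      wedgeGen_mul F (hf a (Finset.mem_insert_self a s)) (Finset.prod_ne_zero_iff.mpr hs), ih hs]

theorem wedgeGen_anticommute (u v : F) :
    wedgeGen F u * wedgeGen F v = -(wedgeGen F v * wedgeGen F u) := by
  by_cases hu : u = 0
  · simp [wedgeGen, hu]
  by_cases hv : v = 0
  · simp [wedgeGen, hv]
  rw [wedgeGen_of_ne_zero F hu, wedgeGen_of_ne_zero F hv, eq_neg_iff_add_eq_zero]
  exact ExteriorAlgebra.ι_add_mul_swap _ _

end WedgeGen

/-- For `x₁, …, xₙ ∉ {0, 1, -1}` (indexed cyclically, `x_{i+n} = x_i`) and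
`z = ∏ᵢ (1-xᵢ)/(1+xᵢ)`, one has, in `Λ^{n+1}` of `ℚ ⊗_ℤ Fˣ`:
`x₁∧⋯∧xₙ∧z = ∑ᵢ (-1)^{i(n-1)} ( xᵢ∧(1-xᵢ)∧x_{i+1}∧⋯∧x_{i+n-1}
  - xᵢ∧(1+xᵢ)∧x_{i+1}∧⋯∧x_{i+n-1} )`. -/
theorem wedge_identity_n_family (F : Type) [Field F] (n : ℕ) (hn : 1 ≤ n) (x : ℕ → F)
    (hcyc : ∀ i, x (i + n) = x i)
    (hx0 : ∀ i, x i ≠ 0) (hx1 : ∀ i, x i ≠ 1) (hx1' : ∀ i, x i ≠ -1)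
    (z : F) (hz : z = ∏ i ∈ Finset.Icc 1 n, (1 - x i) / (1 + x i)) :
    (((List.range n).map (fun j => wedgeGen F (x (j + 1)))).prod * wedgeGen F z)
      = ∑ i ∈ Finset.Icc 1 n,
          ((-1 : ℚ) ^ (i * (n - 1))) •
            (wedgeGen F (x i) * wedgeGen F (1 - x i) *
                ((List.range (n - 1)).map (fun j => wedgeGen F (x (i + 1 + j)))).prod
              - wedgeGen F (x i) * wedgeGen F (1 + x i) *
                ((List.range (n - 1)).map (fun j => wedgeGen F (x (i + 1 + j)))).prod) := by
  obtain ⟨m, rfl⟩ : ∃ m, n = m + 1 := ⟨n - 1, by omega⟩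
  have hsub (i : ℕ) : 1 - x i ≠ 0 := sub_ne_zero.mpr (hx1 i).symm
  have hadd (i : ℕ) : 1 + x i ≠ 0 := fun h => hx1' i (eq_neg_of_add_eq_zero_right h)
  rw [hz, wedgeGen_prod F _ _ fun i _ => div_ne_zero (hsub i) (hadd i), Finset.mul_sum]
  refine Finset.sum_congr rfl fun i hi => ?_
  obtain ⟨k, rfl⟩ : ∃ k, i = k + 1 := ⟨i - 1, by have := (Finset.mem_Icc.mp hi).1; omega⟩
  have key (b : F) := List.prod_map_range_mul_eq_insert_of_anticommute
    (fun i => wedgeGen F (x i)) (wedgeGen F b) m (fun _ _ => wedgeGen_anticommute F _ _)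
    (fun i => by rw [hcyc]) (fun _ => wedgeGen_anticommute F _ _) k
  rw [wedgeGen_div F (hsub _) (hadd _), mul_sub, key, key, ← mul_sub, Algebra.smul_def]
  simp
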